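/- arXiv:1907.01691 — 5 statements merged into one kernel-verified Lean document; each statement's English description precedes it below -/
import Mathlib

section
/- Let T, k, l be natural numbers with 1 ≤ k, T ≥ 2k, l ≥ 1, and let ε > 0 be real. Then the number of quantization bits b := T · R_ε(l) satisfies b ≤ (1+ε)·k·(log₂ T + log₂ l). In particular, for fixed k, l and ε, b grows at most as O(k·log T + k·log l) as T → ∞. -/
/-- The SQuaTS rate threshold
`R_ε(l) = max_{1 ≤ i ≤ k} ((1+ε)·k/(i·T))·log₂( C(T−k, i) · l^i )`. -/
noncomputable def squatsRate (T k l : ℕ) (ε : ℝ) (hk : (Finset.Icc 1 k).Nonempty) : ℝ :=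
  (Finset.Icc 1 k).sup' hk fun i =>
    (1 + ε) * (k : ℝ) / ((i : ℝ) * (T : ℝ)) *
      Real.logb 2 (((T - k).choose i : ℝ) * (l : ℝ) ^ i)

theorem logb_choose_mul_pow_le {b : ℝ} (hb : 1 < b) {n T l i : ℕ} (hin : i ≤ n) (hnT : n ≤ T)
    (hT : 1 ≤ T) (hl : 1 ≤ l) :
    Real.logb b ((n.choose i : ℝ) * (l : ℝ) ^ i) ≤
      (i : ℝ) * (Real.logb b (T : ℝ) + Real.logb b (l : ℝ)) := by
  have hT0 : (0 : ℝ) < T := by exact_mod_cast hT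
  have hl0 : (0 : ℝ) < l := by exact_mod_cast hl
  have hc0 : (0 : ℝ) < n.choose i := by exact_mod_cast Nat.choose_pos hin
  have hc : (n.choose i : ℝ) ≤ (T : ℝ) ^ i := by
    exact_mod_cast (Nat.choose_le_pow n i).trans (Nat.pow_le_pow_left hnT i)
  calc Real.logb b ((n.choose i : ℝ) * (l : ℝ) ^ i)
      ≤ Real.logb b (((T : ℝ) * l) ^ i) := by
        apply Real.logb_le_logb_of_le hb (by positivity)
        rw [mul_pow]
        gcongr
    _ = (i : ℝ) * (Real.logb b (T : ℝ) + Real.logb b (l : ℝ)) := by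
        rw [Real.logb_pow, Real.logb_mul hT0.ne' hl0.ne']

/-- Corollary 2: for `1 ≤ k`, `T ≥ 2k`, `l ≥ 1` and real `ε > 0`, the number of
quantization bits `b := T · R_ε(l)` satisfies `b ≤ (1+ε)·k·(log₂ T + log₂ l)`,
so `b = O(k·log T + k·log l)`. -/
theorem stmt_2 (T k l : ℕ) (hk : 1 ≤ k) (hT : 2 * k ≤ T) (hl : 1 ≤ l)
    (ε : ℝ) (hε : 0 < ε) :
    (T : ℝ) * squatsRate T k l ε (Finset.nonempty_Icc.mpr hk) ≤
      (1 + ε) * (k : ℝ) * (Real.logb 2 (T : ℝ) + Real.logb 2 (l : ℝ)) := by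
  have hT0 : (0 : ℝ) < T := by
    have : 0 < T := by omega
    exact_mod_cast this
  rw [mul_comm, ← le_div_iff₀ hT0, squatsRate]
  apply Finset.sup'_le
  intro i hi
  obtain ⟨hi1, hik⟩ := Finset.mem_Icc.mp hi
  have hi0 : (0 : ℝ) < i := by exact_mod_cast hi1
  calc (1 + ε) * (k : ℝ) / ((i : ℝ) * (T : ℝ)) *
        Real.logb 2 (((T - k).choose i : ℝ) * (l : ℝ) ^ i)
      ≤ (1 + ε) * (k : ℝ) / ((i : ℝ) * (T : ℝ)) *
        ((i : ℝ) * (Real.logb 2 (T : ℝ) + Real.logb 2 (l : ℝ))) := by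
        gcongr
        exact logb_choose_mul_pow_le one_lt_two (by omega) (Nat.sub_le T k) (by omega) hl
    _ = (1 + ε) * (k : ℝ) * (Real.logb 2 (T : ℝ) + Real.logb 2 (l : ℝ)) / T := by
        field_simp
end

section
/- Fix natural numbers k ≥ 1 and l ≥ 1 and a real ε > 0. Then there exists T₀ such that for all T ≥ max(T₀, 2k), the SQuaTS rate threshold satisfies R_ε(l) < log₂(l+1). -/
open Filter Topology in
theorem tendsto_const_div_mul_logb_two (a : ℝ) {l : ℕ} (hl : 1 ≤ l) :
    Tendsto (fun T : ℕ => a / (T : ℝ) * Real.logb 2 ((T : ℝ) * (l : ℝ))) atTop (𝓝 0) := by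
  have hl' : (0 : ℝ) < l := by exact_mod_cast hl
  have hx : Tendsto (fun T : ℕ => (T : ℝ) * (l : ℝ)) atTop atTop :=
    tendsto_natCast_atTop_atTop.atTop_mul_const hl'
  have h := ((Real.isLittleO_log_id_atTop.tendsto_div_nhds_zero).comp hx).const_mul
    (a * l / Real.log 2)
  rw [mul_zero] at h
  refine h.congr fun T => ?_
  rcases Nat.eq_zero_or_pos T with rfl | hT
  · simp
  · have hT' : (0 : ℝ) < T := by exact_mod_cast hT
    have h2 : Real.log 2 ≠ 0 := (Real.log_pos one_lt_two).ne'
    simp only [Function.comp_apply, id, Real.logb]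
    field_simp

theorem logb_choose_mul_pow_le_s4 {n m i l : ℕ} (hi : i ≤ n) (hnm : n ≤ m) (hl : 1 ≤ l) :
    Real.logb 2 ((n.choose i : ℝ) * (l : ℝ) ^ i) ≤ i * Real.logb 2 ((m : ℝ) * (l : ℝ)) := by
  have hc : (0 : ℝ) < n.choose i := by exact_mod_cast Nat.choose_pos hi
  have hl' : (0 : ℝ) < l := by exact_mod_cast hl
  rw [← Real.logb_pow, mul_pow]
  refine Real.logb_le_logb_of_le one_lt_two (by positivity) ?_
  gcongr
  exact_mod_cast (Nat.choose_le_pow n i).trans (Nat.pow_le_pow_left hnm i)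

/-- For fixed `k ≥ 1`, `l ≥ 1` and real `ε > 0`, there exists `T₀` such that for all
`T ≥ max(T₀, 2k)`, the SQuaTS rate threshold satisfies `R_ε(l) < log₂(l+1)`, the rate
of a direct serial scalar quantizer with `l+1` levels. -/
theorem stmt_4 (k l : ℕ) (hk : 1 ≤ k) (hl : 1 ≤ l) (ε : ℝ) (hε : 0 < ε) :
    ∃ T₀ : ℕ, ∀ T : ℕ, max T₀ (2 * k) ≤ T →
      squatsRate T k l ε (Finset.nonempty_Icc.mpr hk) < Real.logb 2 ((l : ℝ) + 1) := by
  have hl' : (0 : ℝ) < l := by exact_mod_cast hl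
  have hpos : 0 < Real.logb 2 ((l : ℝ) + 1) := Real.logb_pos one_lt_two (by linarith)
  obtain ⟨T₀, hT₀⟩ := Filter.eventually_atTop.mp
    ((tendsto_const_div_mul_logb_two ((1 + ε) * k) hl).eventually_lt_const hpos)
  refine ⟨T₀, fun T hT => ?_⟩
  obtain ⟨hT, hkT⟩ := max_le_iff.mp hT
  refine (Finset.sup'_lt_iff _).mpr fun i hi => lt_of_le_of_lt ?_ (hT₀ T hT)
  obtain ⟨hi1, hik⟩ := Finset.mem_Icc.mp hi
  have hi' : (0 : ℝ) < i := by exact_mod_cast hi1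
  have hT' : (0 : ℝ) < T := by exact_mod_cast (by omega : 0 < T)
  calc (1 + ε) * (k : ℝ) / ((i : ℝ) * (T : ℝ)) *
        Real.logb 2 (((T - k).choose i : ℝ) * (l : ℝ) ^ i)
      ≤ (1 + ε) * (k : ℝ) / ((i : ℝ) * (T : ℝ)) * (i * Real.logb 2 ((T : ℝ) * (l : ℝ))) :=
        mul_le_mul_of_nonneg_left
          (logb_choose_mul_pow_le_s4 (by omega) (Nat.sub_le T k) hl) (by positivity)
    _ = (1 + ε) * (k : ℝ) / (T : ℝ) * Real.logb 2 ((T : ℝ) * (l : ℝ)) := by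
        field_simp
end

section
/- Let T, k, l be natural numbers with 1 ≤ k, T ≥ 2k, l ≥ 1, and let ε > 0 be real. Then the CoMa rate threshold strictly exceeds the ML (SQuaTS) rate threshold: R_ε(l) < \bar{R}_ε(l). -/
/-- For `1 ≤ k`, `T ≥ 2k`, `l ≥ 1` and real `ε > 0`, the CoMa rate threshold
`\bar{R}_ε(l) = ((1+ε)·e/T)·k·log₂(T·l)` strictly exceeds the ML (SQuaTS) rate
threshold `R_ε(l)`. -/
theorem stmt_5 (T k l : ℕ) (hk : 1 ≤ k) (hT : 2 * k ≤ T) (hl : 1 ≤ l)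
    (ε : ℝ) (hε : 0 < ε) :
    squatsRate T k l ε (Finset.nonempty_Icc.mpr hk) <
      (1 + ε) * Real.exp 1 / (T : ℝ) * (k : ℝ) * Real.logb 2 ((T : ℝ) * (l : ℝ)) := by
  have hTpos : (0 : ℝ) < T := by exact_mod_cast (by omega : 0 < T)
  have hkpos : (0 : ℝ) < k := by exact_mod_cast hk
  have hlpos : (0 : ℝ) < l := by exact_mod_cast hl
  have hlog : 0 < Real.logb 2 ((T : ℝ) * (l : ℝ)) := by
    refine Real.logb_pos one_lt_two ?_
    have hTl : 1 < T * l := by nlinarith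
    exact_mod_cast hTl
  rw [squatsRate, Finset.sup'_lt_iff]
  intro i hi
  obtain ⟨hi1, hik⟩ := Finset.mem_Icc.mp hi
  have hipos : (0 : ℝ) < i := by exact_mod_cast hi1
  have hchoose : (0 : ℝ) < ((T - k).choose i : ℝ) := by
    exact_mod_cast Nat.choose_pos (by omega : i ≤ T - k)
  have hbound : ((T - k).choose i : ℝ) * (l : ℝ) ^ i ≤ ((T : ℝ) * (l : ℝ)) ^ i := by
    rw [mul_pow]
    gcongr
    exact_mod_cast (Nat.choose_le_pow (T - k) i).trans (Nat.pow_le_pow_left (Nat.sub_le T k) i)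
  have hlogb : Real.logb 2 (((T - k).choose i : ℝ) * (l : ℝ) ^ i) ≤
      i * Real.logb 2 ((T : ℝ) * (l : ℝ)) := by
    rw [← Real.logb_pow]
    exact Real.logb_le_logb_of_le one_lt_two (by positivity) hbound
  calc
    (1 + ε) * (k : ℝ) / ((i : ℝ) * (T : ℝ)) *
        Real.logb 2 (((T - k).choose i : ℝ) * (l : ℝ) ^ i)
      ≤ (1 + ε) * (k : ℝ) / ((i : ℝ) * (T : ℝ)) *
        (i * Real.logb 2 ((T : ℝ) * (l : ℝ))) := by gcongr
    _ = (1 + ε) * 1 / (T : ℝ) * (k : ℝ) * Real.logb 2 ((T : ℝ) * (l : ℝ)) := by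
      field_simp
    _ < (1 + ε) * Real.exp 1 / (T : ℝ) * (k : ℝ) * Real.logb 2 ((T : ℝ) * (l : ℝ)) := by
      gcongr
      exact Real.one_lt_exp_iff.mpr one_pos
end

section
/- Let n, T, k_t, k_s, l be natural numbers with 1 ≤ k_t ≤ n, 1 ≤ k_s ≤ T, l ≥ 1, let k := k_s·k_t, and let ε > 0 be real. Let I(k) := { u_t·u_s : 1 ≤ u_t ≤ k_t, 1 ≤ u_s ≤ k_s }. Then max_{u ∈ I(k)} ((1+ε)·k/(u·n·T))·log₂( C(n,k_t)·C(T,k_s)·l^u ) ≤ max_{1 ≤ u ≤ k} ((1+ε)·k/(u·n·T))·log₂( C(n·T, k)·l^u ); i.e., the rate threshold of Proposition 2 under structured sparsity is at most the rate threshold under overall sparsity. -/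
/-- The product of an `a`-subset and a `b`-subset is an `a * b`-subset of the product, and for
`a, b ≥ 1` it determines both factors. -/
theorem Nat.choose_mul_choose_le_choose_mul {n m a b : ℕ} (ha : 1 ≤ a) (hb : 1 ≤ b) :
    n.choose a * m.choose b ≤ (n * m).choose (a * b) := by
  have h := Finset.card_le_card_of_injOn
    (s := Finset.powersetCard a (Finset.univ : Finset (Fin n)) ×ˢ
      Finset.powersetCard b (Finset.univ : Finset (Fin m)))
    (t := Finset.powersetCard (a * b) (Finset.univ : Finset (Fin n × Fin m)))
    (fun p => p.1 ×ˢ p.2) ?_ ?_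
  · simpa using h
  · rintro ⟨s, t⟩ hst
    simp only [Finset.coe_product, Set.mem_prod, Finset.mem_coe,
      Finset.mem_powersetCard_univ] at hst ⊢
    rw [Finset.card_product, hst.1, hst.2]
  · rintro ⟨s, t⟩ hst ⟨s', t'⟩ hst' heq
    simp only [Finset.coe_product, Set.mem_prod, Finset.mem_coe,
      Finset.mem_powersetCard_univ] at hst hst' heq
    have hs : s.Nonempty := Finset.card_pos.mp (by omega)
    have ht : t.Nonempty := Finset.card_pos.mp (by omega)
    have hs' : s'.Nonempty := Finset.card_pos.mp (by omega)
    have ht' : t'.Nonempty := Finset.card_pos.mp (by omega)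
    refine Prod.ext ?_ ?_
    · rw [← Finset.product_image_fst (s := s) ht, heq, Finset.product_image_fst ht']
    · rw [← Finset.product_image_snd (t := t) hs, heq, Finset.product_image_snd hs']


/-- Proposition 2 comparison: with `1 ≤ k_t ≤ n`, `1 ≤ k_s ≤ T`, `l ≥ 1`,
`k := k_s·k_t` and real `ε > 0`, the distributed SQuaTS rate threshold under
structured sparsity (maximum over `I(k) = {u_t·u_s : 1 ≤ u_t ≤ k_t, 1 ≤ u_s ≤ k_s}`
with `ϑ = C(n,k_t)·C(T,k_s)`) is at most the rate threshold under overall sparsity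
(maximum over `{1,…,k}` with `ϑ = C(n·T, k)`). -/
theorem stmt_8 (n T kt ks l : ℕ) (hkt1 : 1 ≤ kt) (hktn : kt ≤ n)
    (hks1 : 1 ≤ ks) (hksT : ks ≤ T) (hl : 1 ≤ l) (ε : ℝ) (hε : 0 < ε) :
    ((Finset.Icc 1 kt ×ˢ Finset.Icc 1 ks).image fun p => p.1 * p.2).sup'
        (Finset.Nonempty.image
          (Finset.Nonempty.product (Finset.nonempty_Icc.mpr hkt1)
            (Finset.nonempty_Icc.mpr hks1)) _)
        (fun u => (1 + ε) * ((ks * kt : ℕ) : ℝ) / ((u : ℝ) * (n : ℝ) * (T : ℝ)) *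
          Real.logb 2 ((n.choose kt : ℝ) * (T.choose ks : ℝ) * (l : ℝ) ^ u)) ≤
      (Finset.Icc 1 (ks * kt)).sup'
        (Finset.nonempty_Icc.mpr
          (Nat.one_le_iff_ne_zero.mpr (Nat.mul_ne_zero (by omega) (by omega))))
        (fun u => (1 + ε) * ((ks * kt : ℕ) : ℝ) / ((u : ℝ) * (n : ℝ) * (T : ℝ)) *
          Real.logb 2 (((n * T).choose (ks * kt) : ℝ) * (l : ℝ) ^ u)) := by
  refine Finset.sup'_le _ _ fun u hu => ?_
  obtain ⟨⟨ut, us⟩, hp, rfl⟩ := Finset.mem_image.mp hu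
  simp only [Finset.mem_product, Finset.mem_Icc] at hp
  obtain ⟨⟨hut1, hut⟩, hus1, hus⟩ := hp
  refine Finset.le_sup'_of_le _ (b := ut * us) (Finset.mem_Icc.mpr
    ⟨Nat.mul_pos hut1 hus1, mul_comm ks kt ▸ Nat.mul_le_mul hut hus⟩) ?_
  have hchoose : (n.choose kt : ℝ) * (T.choose ks : ℝ) ≤ ((n * T).choose (ks * kt) : ℝ) := by
    rw [mul_comm ks kt]
    exact_mod_cast Nat.choose_mul_choose_le_choose_mul hkt1 hks1
  have hn : (0 : ℝ) < n.choose kt := by exact_mod_cast Nat.choose_pos hktn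
  have hT : (0 : ℝ) < T.choose ks := by exact_mod_cast Nat.choose_pos hksT
  have hl0 : (0 : ℝ) < l := by exact_mod_cast hl
  refine mul_le_mul_of_nonneg_left ?_ (by positivity)
  exact Real.logb_le_logb_of_le one_lt_two (by positivity) (by gcongr)
end

section
/- Let V be a finite type of network nodes, let r and r′ be relations on V with r′ ⊆ r, both with irreflexive transitive closure, let b be a natural number and x : V → ({0,1}^b), and define val_r and val_{r′} by well-founded recursion as val(v) = x(v) OR (the bitwise OR of val(u) over in-neighbors u of v). Fix a node t. If every node u with x(u) ≠ 0 satisfies ReflTransGen r′ u t (each encoder still has at least one path to the decoder after link failures), then val_{r′}(t) = val_r(t) = the bitwise Boolean OR of x(u) over all u ∈ V. -/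
section NetworkJoin

variable {V L : Type*} [Fintype V] [SemilatticeSup L] [OrderBot L]
  {r : V → V → Prop} [DecidableRel r] {x val : V → L}

/-- An upper bound for all inputs bounds every node value of an acyclic join network. -/
theorem val_le_of_forall_input_le (hacyc : Std.Irrefl (Relation.TransGen r))
    (hval : ∀ v, val v = x v ⊔ (Finset.univ.filter fun u => r u v).sup val)
    {c : L} (hx : ∀ u, x u ≤ c) (v : V) : val v ≤ c := by
  have hwf : WellFounded (Relation.TransGen r) := Finite.wellFounded_of_trans_of_irrefl _
  induction v using hwf.induction with
  | _ v ih =>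
    rw [hval v]
    refine sup_le (hx v) (Finset.sup_le fun u hu => ih u (.single ?_))
    simpa using hu

/-- In a join network, an input is below the value of every node it has a path to. -/
theorem input_le_val_of_reflTransGen
    (hval : ∀ v, val v = x v ⊔ (Finset.univ.filter fun u => r u v).sup val)
    {u v : V} (h : Relation.ReflTransGen r u v) : x u ≤ val v := by
  induction h with
  | refl => rw [hval u]; exact le_sup_left
  | @tail w v _ hwv ih =>
    rw [hval v]
    exact ih.trans (le_sup_of_le_right (Finset.le_sup (by simpa using hwv)))

/-- A node of an acyclic join network reachable from every nonzero input receives the join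
of all inputs. -/
theorem val_eq_sup_of_reachable (hacyc : Std.Irrefl (Relation.TransGen r))
    (hval : ∀ v, val v = x v ⊔ (Finset.univ.filter fun u => r u v).sup val)
    {t : V} (hpath : ∀ u, x u ≠ ⊥ → Relation.ReflTransGen r u t) :
    val t = Finset.univ.sup x := by
  refine le_antisymm
    (val_le_of_forall_input_le hacyc hval (fun u => Finset.le_sup (Finset.mem_univ u)) t)
    (Finset.sup_le fun u _ => ?_)
  by_cases hu : x u = ⊥
  · exact hu ▸ bot_le
  · exact input_le_val_of_reflTransGen hval (hpath u hu)

end NetworkJoin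

/-- Robustness to link failures (Section V-C): let `V` be a finite type of nodes, let
`r′ ⊆ r` be directed-link relations, both with irreflexive transitive closure, `b` a
number of bits and `x : V → ({0,1}^b)`, and let `val_r`, `val_{r′}` satisfy the
well-founded recursion `val v = x v ⊔ (bitwise OR of val u over in-neighbors u of v)`
with respect to `r` and `r′` respectively. Fix a node `t`. If every node `u` with
`x u ≠ 0` satisfies `ReflTransGen r′ u t` (each encoder still has a path to the
decoder after link failures), then
`val_{r′} t = val_r t = bitwise OR of x u over all u ∈ V`. -/
theorem stmt_16 {V : Type*} [Fintype V] (r r' : V → V → Prop)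
    [DecidableRel r] [DecidableRel r'] (hsub : ∀ u v, r' u v → r u v)
    (hacyc : Irreflexive (Relation.TransGen r))
    (hacyc' : Irreflexive (Relation.TransGen r')) (b : ℕ)
    (x valr valr' : V → (Fin b → Bool))
    (hvalr : ∀ v, valr v = x v ⊔ (Finset.univ.filter fun u => r u v).sup valr)
    (hvalr' : ∀ v, valr' v = x v ⊔ (Finset.univ.filter fun u => r' u v).sup valr')
    (t : V) (hpath : ∀ u, x u ≠ ⊥ → Relation.ReflTransGen r' u t) :
    valr' t = valr t ∧ valr t = Finset.univ.sup x := by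
  have ht := val_eq_sup_of_reachable ⟨hacyc⟩ hvalr fun u hu =>
    Relation.ReflTransGen.mono hsub _ _ (hpath u hu)
  exact ⟨(val_eq_sup_of_reachable ⟨hacyc'⟩ hvalr' hpath).trans ht.symm, ht⟩
end
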